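/- Let Q be a probability measure on [a,b] with a < b, K a positive integer, and f a continuous, monotone, convex-or-concave function on [a,b] with variation V = |f(b) − f(a)| and linear index Γ ∈ [0,1]. If Q has a modulus of the form w(u) = w(0) + A·u^α/(b−a)^α with A ≥ 1 and α ∈ (0,1], then there exists a 2K-linear interpolation f̄ of f on [a,b] such that ∫_{[a,b]} |f − f̄| dQ ≤ V·[ w(0) + (2^{1−α}·A/(α·K^{1+3α}))^{1/(1+α)} ]. Moreover, if α = 1 and A = 1, the interpolation f̄ satisfies ∫_{[a,b]} |f − f̄| dQ ≤ V·[ w(0) + Γ/K² ]. -/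

import Mathlib

open MeasureTheory Filter
open scoped ENNReal

/-- `l` is a `K`-linear interpolation of `f` on `[a,b]`. -/
def IsLinearInterp (f : ℝ → ℝ) (a b : ℝ) (K : ℕ) (l : ℝ → ℝ) : Prop :=
  ∃ t : Fin (K + 1) → ℝ, t 0 = a ∧ t (Fin.last K) = b ∧ StrictMono t ∧
    ∀ i : Fin K, ∀ y ∈ Set.Icc (t i.castSucc) (t i.succ),
      l y = f (t i.castSucc) +
        (f (t i.succ) - f (t i.castSucc)) / (t i.succ - t i.castSucc) * (y - t i.castSucc)

/-- `w` is a modulus of the Borel measure `μ` on `ℝ`. -/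
def IsModulus (μ : Measure ℝ) (w : ℝ → ℝ) : Prop :=
  (∀ u, 0 ≤ u → 0 ≤ w u) ∧ MonotoneOn w (Set.Ici 0) ∧ ConcaveOn ℝ (Set.Ici 0) w ∧
  ∀ I : Set ℝ, I.OrdConnected → Bornology.IsBounded I →
    μ I ≤ ENNReal.ofReal (w (volume I).toReal)

/-- Division in `[0,∞]` with the convention `0/0 = 1` (and `x/∞ = 0`). -/
noncomputable def cdiv (x y : ℝ≥0∞) : ℝ≥0∞ := if x = 0 ∧ y = 0 then 1 else x / y

/-- The linear index `Γ = 1 − (1/2)·[min(|f'_r(a)|,|f'_l(b)|)/|Δ| + |Δ|/max(|f'_r(a)|,|f'_l(b)|)]`,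
computed from the one-sided derivatives `dra, dlb ∈ [−∞,∞]` and the chord slope `Δ`,
with the conventions `0/0 = 1` and `1/∞ = 0`. -/
noncomputable def linIndex (dra dlb : EReal) (Δ : ℝ) : ℝ :=
  1 - (1 / 2) * ((cdiv (min dra.abs dlb.abs) (ENNReal.ofReal |Δ|)).toReal
      + (cdiv (ENNReal.ofReal |Δ|) (max dra.abs dlb.abs)).toReal)

/-- A convex function has a subgradient at every interior point of an interval. -/
lemma exists_subgradient {f : ℝ → ℝ} {a b x : ℝ} (hf : ConvexOn ℝ (Set.Icc a b) f)
    (hx : x ∈ Set.Ioo a b) :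
    ∃ m : ℝ, ∀ z ∈ Set.Icc a b, f x + m * (z - x) ≤ f z := by
  obtain ⟨hax, hxb⟩ := hx
  have hx' : x ∈ Set.Icc a b := ⟨hax.le, hxb.le⟩
  have lower : ∀ z ∈ Set.Ico a x, ∀ z' ∈ Set.Ioc x b,
      (f z - f x) / (z - x) ≤ (f z' - f x) / (z' - x) := fun z hz z' hz' =>
    hf.secant_mono hx' ⟨hz.1, hz.2.le.trans hxb.le⟩ ⟨hax.le.trans hz'.1.le, hz'.2⟩
      hz.2.ne hz'.1.ne' (hz.2.trans hz'.1).le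
  set T : Set ℝ := (fun z => (f z - f x) / (z - x)) '' Set.Ioc x b with hT
  have hbdd : BddBelow T := by
    refine ⟨(f a - f x) / (a - x), ?_⟩
    rintro _ ⟨z', hz', rfl⟩
    exact lower a ⟨le_rfl, hax⟩ z' hz'
  have hne : T.Nonempty := ⟨_, b, ⟨hxb, le_rfl⟩, rfl⟩
  refine ⟨sInf T, fun z hz => ?_⟩
  rcases lt_trichotomy z x with h | rfl | h
  · have h1 : (f z - f x) / (z - x) ≤ sInf T := by
      refine le_csInf hne ?_
      rintro _ ⟨z', hz', rfl⟩
      exact lower z ⟨hz.1, h⟩ z' hz'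
    rw [div_le_iff_of_neg (by linarith)] at h1
    linarith
  · simp
  · have h1 : sInf T ≤ (f z - f x) / (z - x) := csInf_le hbdd ⟨z, ⟨h, hz.2⟩, rfl⟩
    rw [le_div_iff₀ (by linarith)] at h1
    linarith

/-- A monotone function on an interval crosses a given level at some point. -/
lemma exists_level_cut {G : ℝ → ℝ} {a b : ℝ} (hab : a ≤ b) (hG : MonotoneOn G (Set.Ioo a b))
    (θ : ℝ) :
    ∃ c ∈ Set.Icc a b, (∀ x ∈ Set.Ioo a c, G x ≤ θ) ∧ ∀ x ∈ Set.Ioo c b, θ < G x := by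
  set T : Set ℝ := insert a {x | x ∈ Set.Ioo a b ∧ G x ≤ θ} with hT
  have hub : b ∈ upperBounds T := by
    rintro x (rfl | hx)
    exacts [hab, hx.1.2.le]
  have hbdd : BddAbove T := ⟨b, hub⟩
  have haT : a ∈ T := Set.mem_insert _ _
  have hac : a ≤ sSup T := le_csSup hbdd haT
  have hcb : sSup T ≤ b := csSup_le ⟨a, haT⟩ hub
  refine ⟨sSup T, ⟨hac, hcb⟩, fun x hx => ?_, fun x hx => ?_⟩
  · obtain ⟨y, hy, hxy⟩ := exists_lt_of_lt_csSup ⟨a, haT⟩ hx.2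
    rcases hy with rfl | hy
    · exact absurd hx.1 hxy.not_gt
    · exact (hG ⟨hx.1, hx.2.trans_le hcb⟩ hy.1 hxy.le).trans hy.2
  · by_contra! h
    exact (le_csSup hbdd (Or.inr ⟨⟨hac.trans_lt hx.1, hx.2⟩, h⟩)).not_gt hx.1

/-- A monotone function of oscillation at most `K * h` can be cut at `K - 1` points
so that it oscillates by at most `h` on every open interval avoiding the cuts. -/
lemma exists_oscillation_cuts {G : ℝ → ℝ} {a b : ℝ} (hab : a ≤ b)
    (hG : MonotoneOn G (Set.Ioo a b)) {K : ℕ} (hK : 1 ≤ K) {lo h : ℝ}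
    (hlo : ∀ x ∈ Set.Ioo a b, lo ≤ G x) (hhi : ∀ x ∈ Set.Ioo a b, G x ≤ lo + K * h) :
    ∃ S : Finset ℝ, S.card ≤ K - 1 ∧ ↑S ⊆ Set.Icc a b ∧
      ∀ u v, a ≤ u → v ≤ b → (∀ x ∈ S, x ∉ Set.Ioo u v) →
        ∀ x ∈ Set.Ioo u v, ∀ x' ∈ Set.Ioo u v, x ≤ x' → G x' - G x ≤ h := by
  choose c hc hcl hcr using fun i : ℕ => exists_level_cut hab hG (lo + (i + 1) * h)
  refine ⟨(Finset.range (K - 1)).image c, Finset.card_image_le.trans (by simp), ?_, ?_⟩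
  · intro x hx
    simp only [Finset.coe_image, Set.mem_image] at hx
    obtain ⟨i, -, rfl⟩ := hx
    exact hc i
  intro u v hau hvb havoid x hx x' hx' hxx'
  have hxI : x ∈ Set.Ioo a b := ⟨hau.trans_lt hx.1, hx.2.trans_le hvb⟩
  have hxI' : x' ∈ Set.Ioo a b := ⟨hau.trans_lt hx'.1, hx'.2.trans_le hvb⟩
  have hlx := hlo x hxI
  have hhx := hhi x' hxI'
  have hxx := hG hxI hxI' hxx'
  have hK0 : (0 : ℝ) < K := by exact_mod_cast hK
  have hh : 0 ≤ h := by
    by_contra! hneg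
    nlinarith
  rcases hh.eq_or_lt with rfl | hpos
  · simp only [mul_zero, add_zero] at hhx
    linarith
  set i : ℕ := ⌊(G x - lo) / h⌋₊ with hi
  have hi1 : (i : ℝ) * h ≤ G x - lo :=
    (le_div_iff₀ hpos).1 (Nat.floor_le (div_nonneg (by linarith) hpos.le))
  have hi2 : G x - lo < ((i : ℝ) + 1) * h := (div_lt_iff₀ hpos).1 (Nat.lt_floor_add_one _)
  by_cases hiK : i + 1 < K
  · have hav := havoid (c i) (Finset.mem_image_of_mem _ (Finset.mem_range.2 (by omega)))
    have hxc : x ≤ c i := by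
      by_contra! hlt
      linarith [hcr i x ⟨hlt, hxI.2⟩]
    have hvc : v ≤ c i := by
      by_contra! hlt
      exact hav ⟨hx.1.trans_le hxc, hlt⟩
    linarith [hcl i x' ⟨hxI'.1, hx'.2.trans_le hvc⟩]
  · have : (K : ℝ) ≤ i + 1 := by exact_mod_cast (not_lt.1 hiK)
    nlinarith

/-- The vertical distance at `z` between `f` and its chord on `[u, v]`. -/
noncomputable def chordErr (f : ℝ → ℝ) (u v z : ℝ) : ℝ :=
  |(v - z) * (f u - f z) + (z - u) * (f v - f z)| / (v - u)

lemma abs_sub_chord_eq {f : ℝ → ℝ} {u v : ℝ} (huv : u < v) (z : ℝ) :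
    |f z - (f u + (f v - f u) / (v - u) * (z - u))| = chordErr f u v z := by
  have h : 0 < v - u := sub_pos.2 huv
  rw [chordErr, eq_div_iff h.ne']
  nth_rewrite 2 [← abs_of_pos h]
  rw [← abs_mul, ← abs_neg]
  congr 1
  field_simp
  ring

/-- If the subgradients `m` of `f` satisfy `(x' - x) * (m x' - m x) ≤ C` on `(u, v)`, then `f` is
within `C / 4` of its chord on `[u, v]`. -/
lemma chord_gap_le_of_subgradient {f m : ℝ → ℝ} {u v C : ℝ} (hf : ContinuousOn f (Set.Icc u v))
    (hm : ∀ x ∈ Set.Ioo u v, ∀ z ∈ Set.Icc u v, f x + m x * (z - x) ≤ f z)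
    (hC : 0 ≤ C)
    (hosc : ∀ x ∈ Set.Ioo u v, ∀ x' ∈ Set.Ioo u v, x ≤ x' → (x' - x) * (m x' - m x) ≤ C)
    {z : ℝ} (hz : z ∈ Set.Icc u v) :
    (v - z) * (f u - f z) + (z - u) * (f v - f z) ≤ (v - u) * (C / 4) := by
  rcases hz.1.eq_or_lt with rfl | huz
  · simp only [sub_self, mul_zero, zero_mul, add_zero]
    exact mul_nonneg (by linarith [hz.2]) (by linarith)
  rcases hz.2.eq_or_lt with rfl | hzv
  · simp only [sub_self, mul_zero, zero_mul, add_zero]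
    exact mul_nonneg (by linarith [hz.1]) (by linarith)
  have key : ∀ q ∈ Set.Ioo u z ×ˢ Set.Ioo z v,
      (q.2 - z) * (f q.1 - f z) + (z - q.1) * (f q.2 - f z) ≤ (q.2 - q.1) * (C / 4) := by
    rintro ⟨x, x'⟩ ⟨hx, hx'⟩
    simp only at hx hx' ⊢
    have hxm : x ∈ Set.Ioo u v := ⟨hx.1, hx.2.trans hzv⟩
    have hxm' : x' ∈ Set.Ioo u v := ⟨huz.trans hx'.1, hx'.2⟩
    have h1 := hm x hxm z hz
    have h2 := hm x' hxm' z hz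
    have h3 := hosc x hxm x' hxm' (hx.2.trans hx'.1).le
    have p1 : 0 < z - x := sub_pos.2 hx.2
    have p2 : 0 < x' - z := sub_pos.2 hx'.1
    have h4 : (x' - z) * (f x - f z) + (z - x) * (f x' - f z)
        ≤ (m x' - m x) * ((z - x) * (x' - z)) := by nlinarith
    rcases le_total (m x' - m x) 0 with hneg | hpos
    · have : 0 ≤ (x' - x) * (C / 4) := mul_nonneg (by linarith) (by linarith)
      nlinarith [mul_pos p1 p2]
    · have h5 : (z - x) * (x' - z) ≤ (x' - x) ^ 2 / 4 := by
        nlinarith [sq_nonneg ((z - x) - (x' - z))]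
      have h6 := mul_le_mul_of_nonneg_left h5 hpos
      have h7 := mul_le_mul_of_nonneg_left h3 (show 0 ≤ (x' - x) / 4 by linarith)
      linarith
  have hcl : closure (Set.Ioo u z ×ˢ Set.Ioo z v) = Set.Icc u z ×ˢ Set.Icc z v := by
    rw [closure_prod_eq, closure_Ioo huz.ne, closure_Ioo hzv.ne]
  have c1 : ContinuousOn (fun q : ℝ × ℝ => f q.1) (Set.Icc u z ×ˢ Set.Icc z v) :=
    hf.comp continuousOn_fst fun q hq => ⟨hq.1.1, hq.1.2.trans hz.2⟩
  have c2 : ContinuousOn (fun q : ℝ × ℝ => f q.2) (Set.Icc u z ×ˢ Set.Icc z v) :=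
    hf.comp continuousOn_snd fun q hq => ⟨hz.1.trans hq.2.1, hq.2.2⟩
  have hcont : ContinuousOn
      (fun q : ℝ × ℝ => (q.2 - z) * (f q.1 - f z) + (z - q.1) * (f q.2 - f z))
      (Set.Icc u z ×ˢ Set.Icc z v) :=
    ((continuousOn_snd.sub continuousOn_const).mul (c1.sub continuousOn_const)).add
      ((continuousOn_const.sub continuousOn_fst).mul (c2.sub continuousOn_const))
  have := le_on_closure key (by rwa [hcl]) (by rw [hcl]; fun_prop)
    (x := (u, v)) (by rw [hcl]; exact ⟨⟨le_rfl, hz.1⟩, ⟨hz.2, le_rfl⟩⟩)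
  exact this

lemma chord_gap_nonneg {f : ℝ → ℝ} {u v z : ℝ} (hf : ConvexOn ℝ (Set.Icc u v) f)
    (hz : z ∈ Set.Icc u v) :
    0 ≤ (v - z) * (f u - f z) + (z - u) * (f v - f z) := by
  rcases hz.1.eq_or_lt with rfl | huz
  · simp
  rcases hz.2.eq_or_lt with rfl | hzv
  · simp
  have := hf.secant_mono_aux1 (Set.left_mem_Icc.2 (huz.trans hzv).le)
    (Set.right_mem_Icc.2 (huz.trans hzv).le) huz hzv
  linarith

/-- Concavity of `x ^ α / α` at `r`. -/
lemma rpow_sub_one_mul_sub_le {α r r' : ℝ} (hα : α ∈ Set.Ioc (0 : ℝ) 1) (hr : 0 < r)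
    (hr' : 0 ≤ r') : r ^ (α - 1) * (r - r') ≤ (r ^ α - r' ^ α) / α := by
  have h := rpow_one_add_le_one_add_mul_self (s := r' / r - 1)
    (by linarith [div_nonneg hr' hr.le]) hα.1.le hα.2
  rw [add_sub_cancel, Real.div_rpow hr' hr.le, div_le_iff₀ (Real.rpow_pos_of_pos hr _)] at h
  rw [le_div_iff₀ hα.1, Real.rpow_sub_one hr.ne']
  have : (1 + α * (r' / r - 1)) * r ^ α = r ^ α - r ^ α / r * (r - r') * α := by
    field_simp
    ring
  linarith

/-- Bound for the gap `e` between a convex arc of height `H` over a base `l` and its chord, given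
bounds `r` and `r'` on the inverse slopes at both ends. -/
lemma chord_gap_mul_rpow_le {α e l H r r' : ℝ} (hα : α ∈ Set.Ioc (0 : ℝ) 1) (he : 0 ≤ e)
    (hl : 0 < l) (hH : 0 ≤ H) (hr : 0 < r) (hr' : 0 ≤ r') (hrr : r' ≤ r)
    (h1 : e * r ≤ (r - r') * H) (h2 : e * l ≤ (r - r') * (H ^ 2 / 4)) :
    e * l ^ α ≤ H ^ (1 + α) * (1 / 4) ^ α * ((r ^ α - r' ^ α) / α) := by
  have hd : 0 ≤ r - r' := by linarith
  have e1 : e * l ^ α = e ^ (1 - α) * (e * l) ^ α := by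
    rw [Real.mul_rpow he hl.le, ← mul_assoc, ← Real.rpow_add' he (by simp)]
    simp
  have b1 : e ^ (1 - α) ≤ ((r - r') * H / r) ^ (1 - α) :=
    Real.rpow_le_rpow he ((le_div_iff₀ hr).2 h1) (by linarith [hα.2])
  have b2 : (e * l) ^ α ≤ ((r - r') * (H ^ 2 / 4)) ^ α :=
    Real.rpow_le_rpow (by positivity) h2 hα.1.le
  have e2 : ((r - r') * H / r) ^ (1 - α) * ((r - r') * (H ^ 2 / 4)) ^ α
      = H ^ (1 + α) * (1 / 4) ^ α * (r ^ (α - 1) * (r - r')) := by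
    have t1 : (r - r') ^ (1 - α) * (r - r') ^ α = r - r' := by
      rw [← Real.rpow_add' hd (by simp)]; simp
    have t2 : H ^ (1 - α) * (H ^ 2) ^ α = H ^ (1 + α) := by
      rw [← Real.rpow_natCast H 2, ← Real.rpow_mul hH, ← Real.rpow_add' hH]
      · congr 1; push_cast; ring
      · have := hα.1; push_cast; linarith
    have t3 : r ^ (α - 1) = (r ^ (1 - α))⁻¹ := by
      rw [← Real.rpow_neg hr.le]; congr 1; ring
    rw [show H ^ 2 / 4 = H ^ 2 * (1 / 4) by ring, Real.div_rpow (by positivity) hr.le,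
      Real.mul_rpow hd hH, Real.mul_rpow hd (by positivity),
      Real.mul_rpow (by positivity) (by norm_num), ← t2, t3]
    conv_rhs => rw [← t1]
    ring
  calc e * l ^ α ≤ ((r - r') * H / r) ^ (1 - α) * ((r - r') * (H ^ 2 / 4)) ^ α := by
        rw [e1]; exact mul_le_mul b1 b2 (by positivity) (by positivity)
    _ ≤ _ := by
        rw [e2]
        exact mul_le_mul_of_nonneg_left (rpow_sub_one_mul_sub_le hα hr hr') (by positivity)

/-- `f` admits at most `n` nodes in `[a, b]` such that, on any interval avoiding them, the distance
from `f` to its chord exceeds `E` by an amount controlled, relative to the weight `w`, by a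
monotone potential of total increase at most `B`. -/
def HasChordControl (f : ℝ → ℝ) (a b : ℝ) (n : ℕ) (w : ℝ → ℝ) (E B : ℝ) : Prop :=
  ∃ S : Finset ℝ, S.card ≤ n ∧ ↑S ⊆ Set.Icc a b ∧
    ∃ Φ : ℝ → ℝ, MonotoneOn Φ (Set.Icc a b) ∧ Φ b - Φ a ≤ B ∧
      ∀ u v, a ≤ u → u < v → v ≤ b → (∀ x ∈ S, x ∉ Set.Ioo u v) →
        ∀ z ∈ Set.Icc u v, (chordErr f u v z - E) * w (v - u) ≤ Φ v - Φ u

/-- Where the slopes of `f` lie between `p` and `s`, suitable `K - 1` nodes bring `f` within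
`(s - p) * (c - a) / (4 * K ^ 2)` of its chords. -/
lemma exists_nodes_of_slope_le {f m : ℝ → ℝ} {a b c p s : ℝ} {K : ℕ} (hK : 1 ≤ K)
    (hcont : ContinuousOn f (Set.Icc a b)) (hcvx : ConvexOn ℝ (Set.Icc a b) f)
    (hc : c ∈ Set.Icc a b) (hps : p ≤ s)
    (hm : ∀ x ∈ Set.Ioo a b, ∀ z ∈ Set.Icc a b, f x + m x * (z - x) ≤ f z)
    (hmono : MonotoneOn m (Set.Ioo a b))
    (hpm : ∀ x ∈ Set.Ioo a b, p ≤ m x) (hms : ∀ x ∈ Set.Ioo a c, m x ≤ s) :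
    ∃ S : Finset ℝ, S.card ≤ K - 1 ∧ ↑S ⊆ Set.Icc a b ∧
      ∀ u v, a ≤ u → u < v → v ≤ c → (∀ x ∈ S, x ∉ Set.Ioo u v) →
        ∀ z ∈ Set.Icc u v, chordErr f u v z ≤ (s - p) * (c - a) / (4 * K ^ 2) := by
  have hK0 : (0 : ℝ) < K := by exact_mod_cast hK
  have hl : 0 ≤ c - a := sub_nonneg.2 hc.1
  have hsp : 0 ≤ s - p := sub_nonneg.2 hps
  have hsub : ∀ x ∈ Set.Ioo a c, x ∈ Set.Ioo a b := fun x hx => ⟨hx.1, hx.2.trans_le hc.2⟩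
  obtain ⟨S, hcard, hS, hosc⟩ := exists_oscillation_cuts
    (G := fun x => (s - p) * (x - a) + (c - a) * (m x - p)) (a := a) (b := c) hc.1
    (lo := 0) (h := 2 * ((s - p) * (c - a)) / K)
    (fun x hx y hy hxy => by
      have := hmono (hsub x hx) (hsub y hy) hxy
      simp only
      gcongr) hK
    (fun x hx => by
      have := hpm x (hsub x hx)
      have h1 : 0 ≤ x - a := by linarith [hx.1]
      have h2 : 0 ≤ m x - p := by linarith
      positivity)
    (fun x hx => by
      have e : (0 : ℝ) + K * (2 * ((s - p) * (c - a)) / K)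
          = (s - p) * (c - a) + (c - a) * (s - p) := by
        field_simp; ring
      rw [e]
      have := hms x hx
      have := hx.2.le
      gcongr)
  refine ⟨S, hcard, hS.trans (Set.Icc_subset_Icc_right hc.2), fun u v hau huv hvc hav z hz => ?_⟩
  have hsubI : Set.Icc u v ⊆ Set.Icc a b := Set.Icc_subset_Icc hau (hvc.trans hc.2)
  have hsubO : Set.Ioo u v ⊆ Set.Ioo a b := Set.Ioo_subset_Ioo hau (hvc.trans hc.2)
  have hl' : 0 < c - a := by linarith
  have gap := chord_gap_le_of_subgradient (C := (s - p) * (c - a) / K ^ 2)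
    (hcont.mono hsubI) (fun x hx z hz => hm x (hsubO hx) z (hsubI hz)) (by positivity)
    (fun x hx x' hx' hxx' => by
      have h1 := hosc u v hau hvc hav x hx x' hx' hxx'
      have h2 := hmono (hsubO hx) (hsubO hx') hxx'
      rw [le_div_iff₀ hK0] at h1
      rw [le_div_iff₀ (by positivity)]
      set d := x' - x
      set δ := m x' - m x
      have hd : 0 ≤ d := sub_nonneg.2 hxx'
      have hδ : 0 ≤ δ := sub_nonneg.2 h2
      have h3 : ((s - p) * d + (c - a) * δ) * K ≤ 2 * ((s - p) * (c - a)) := by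
        refine le_trans (le_of_eq ?_) h1
        simp only [d, δ]; ring
      rcases hsp.eq_or_lt with h0 | h0
      · rw [← h0] at h3 ⊢
        have : δ ≤ 0 := by
          by_contra! hpos
          have : 0 < (c - a) * δ * K := by positivity
          linarith
        have : δ = 0 := le_antisymm this hδ
        simp [this]
      · have h4 : (((s - p) * d + (c - a) * δ) * K) ^ 2 ≤ (2 * ((s - p) * (c - a))) ^ 2 :=
          pow_le_pow_left₀ (by positivity) h3 2
        have h5 : 4 * ((s - p) * d * ((c - a) * δ)) * K ^ 2
            ≤ (((s - p) * d + (c - a) * δ) * K) ^ 2 := by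
          rw [mul_pow]
          gcongr
          nlinarith [sq_nonneg ((s - p) * d - (c - a) * δ)]
        have hpos : 0 < 4 * ((s - p) * (c - a)) := by positivity
        refine le_of_mul_le_mul_left ?_ hpos
        calc 4 * ((s - p) * (c - a)) * (d * δ * K ^ 2)
            = 4 * ((s - p) * d * ((c - a) * δ)) * K ^ 2 := by ring
          _ ≤ (2 * ((s - p) * (c - a))) ^ 2 := h5.trans h4
          _ = _ := by ring)
    hz
  rw [chordErr, abs_of_nonneg (chord_gap_nonneg (hcvx.subset hsubI (convex_Icc u v)) hz),
    div_le_iff₀ (by linarith)]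
  refine gap.trans (le_of_eq ?_)
  field_simp

/-- A convex nondecreasing function is controlled by inverse slopes beyond the point `c` where its
slope exceeds `s`. -/
lemma exists_inverse_slope {f m : ℝ → ℝ} {a b c s R : ℝ}
    (hcont : ContinuousOn f (Set.Icc a b)) (hfm : MonotoneOn f (Set.Icc a b))
    (hc : c ∈ Set.Icc a b) (hs : 0 < s) (hR0 : 0 ≤ R) (hRs : R * s ≤ 1)
    (hR : ∀ z ∈ Set.Icc a b, R * (f b - f z) ≤ b - z)
    (hm : ∀ x ∈ Set.Ioo a b, ∀ z ∈ Set.Icc a b, f x + m x * (z - x) ≤ f z)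
    (hms : ∀ x ∈ Set.Ioo c b, s < m x) :
    ∃ r : ℝ → ℝ, AntitoneOn r (Set.Icc a b) ∧ (∀ x, 0 ≤ r x) ∧ (∀ x < b, 0 < r x) ∧
      r a = 1 / s ∧ R ≤ r b ∧
      ∀ x ∈ Set.Icc c b, ∀ z ∈ Set.Icc c b, z - x ≤ r x * (f z - f x) := by
  have hcb : Set.Icc c b ⊆ Set.Icc a b := Set.Icc_subset_Icc_left hc.1
  have slope_c : ∀ z ∈ Set.Icc c b, s * (z - c) ≤ f z - f c := by
    intro z hz
    rcases hz.1.eq_or_lt with rfl | hcz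
    · simp
    have key : ∀ x ∈ Set.Ioo c z, s * (z - x) ≤ f z - f x := by
      intro x hx
      have h1 := hms x ⟨hx.1, hx.2.trans_le hz.2⟩
      have h2 := hm x ⟨hc.1.trans_lt hx.1, hx.2.trans_le hz.2⟩ z (hcb hz)
      nlinarith [hx.2]
    have hcl : closure (Set.Ioo c z) = Set.Icc c z := closure_Ioo hcz.ne
    have c1 : ContinuousOn f (Set.Icc c z) := hcont.mono (Set.Icc_subset_Icc hc.1 hz.2)
    exact le_on_closure key (by rw [hcl]; fun_prop) (by rw [hcl]; fun_prop)
      (by rw [hcl]; exact Set.left_mem_Icc.2 hz.1)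
  set r : ℝ → ℝ := fun x => if x ≤ c then 1 / s else if x < b then 1 / m x else R with hr
  have r_le : ∀ x ≤ c, r x = 1 / s := fun x hx => by simp only [hr, if_pos hx]
  have r_pos : ∀ x < b, 0 < r x := by
    intro x hx
    by_cases hxc : x ≤ c
    · rw [r_le x hxc]; positivity
    · simp only [hr, if_neg hxc, if_pos hx]
      exact one_div_pos.2 (hs.trans (hms x ⟨not_le.1 hxc, hx⟩))
  have r_nonneg : ∀ x, 0 ≤ r x := by
    intro x
    by_cases hx : x < b
    · exact (r_pos x hx).le
    · simp only [hr, if_neg hx]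
      split_ifs
      exacts [by positivity, hR0]
  have r_slope : ∀ x ∈ Set.Icc c b, ∀ z ∈ Set.Icc c b, z - x ≤ r x * (f z - f x) := by
    intro x hx z hz
    rcases hx.1.eq_or_lt with rfl | hcx
    · rw [r_le c le_rfl, one_div_mul_eq_div, le_div_iff₀ hs]
      linarith [slope_c z hz]
    rcases hx.2.eq_or_lt with rfl | hxb
    · simp only [hr, if_neg hcx.not_ge, lt_irrefl, if_false]
      linarith [hR z (hcb hz)]
    · have hmx := hs.trans (hms x ⟨hcx, hxb⟩)
      simp only [hr, if_neg hcx.not_ge, if_pos hxb]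
      rw [one_div_mul_eq_div, le_div_iff₀ hmx]
      linarith [hm x ⟨hc.1.trans_lt hcx, hxb⟩ z (hcb hz)]
  have r_anti : ∀ x ∈ Set.Icc c b, ∀ y ∈ Set.Icc c b, x ≤ y → r y ≤ r x := by
    intro x hx y hy hxy
    rcases hxy.eq_or_lt with rfl | hxy
    · exact le_rfl
    have h1 := r_slope x hx y hy
    have h2 := r_slope y hy x hx
    have hf : 0 < f y - f x := by
      by_contra! hneg
      nlinarith [r_nonneg x]
    refine le_of_mul_le_mul_right ?_ hf
    linarith
  refine ⟨r, fun x hx y hy hxy => ?_, r_nonneg, r_pos, r_le a hc.1, ?_, r_slope⟩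
  · rcases le_total c x with hcx | hxc
    · exact r_anti x ⟨hcx, hx.2⟩ y ⟨hcx.trans hxy, hy.2⟩ hxy
    · rcases le_total y c with hyc | hcy
      · rw [r_le x hxc, r_le y hyc]
      · rw [r_le x hxc, ← r_le c le_rfl]
        exact r_anti c ⟨le_rfl, hc.2⟩ y ⟨hcy, hy.2⟩ hcy
  · by_cases hbc : b ≤ c
    · rw [r_le b hbc, le_div_iff₀ hs]; exact hRs
    · simp only [hr, if_neg hbc, lt_irrefl, if_false, le_refl]

/-- Bounds for the distance to the chord of a nondecreasing function with inverse slopes at most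
`r` at the left end and at least `r'` at the right end. -/
lemma chord_gap_le_of_inverse_slope {f : ℝ → ℝ} {u v z r r' : ℝ}
    (hf : MonotoneOn f (Set.Icc u v)) (hz : z ∈ Set.Icc u v) (hrr : r' ≤ r)
    (h1 : z - u ≤ r * (f z - f u)) (h2 : r' * (f v - f z) ≤ v - z)
    (h3 : r' * (f v - f u) ≤ v - u) :
    let N := (v - z) * (f u - f z) + (z - u) * (f v - f z)
    N ≤ (v - u) * (f v - f u) ∧ N ≤ (r - r') * ((f v - f u) ^ 2 / 4) ∧
      N * r ≤ (v - u) * ((r - r') * (f v - f u)) := by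
  intro N
  have huv : u ≤ v := hz.1.trans hz.2
  have m1 : f u ≤ f z := hf (Set.left_mem_Icc.2 huv) hz hz.1
  have m2 : f z ≤ f v := hf hz (Set.right_mem_Icc.2 huv) hz.2
  obtain ⟨zu, zv⟩ := hz
  have hrr' : 0 ≤ r - r' := by linarith
  refine ⟨?_, ?_, ?_⟩
  · have q1 : (v - z) * (f u - f z) ≤ 0 :=
      mul_nonpos_of_nonneg_of_nonpos (by linarith) (by linarith)
    have q2 : (z - u) * (f v - f z) ≤ (v - u) * (f v - f u) :=
      mul_le_mul (by linarith) (by linarith) (by linarith) (by linarith)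
    linarith
  · have q1 := mul_le_mul_of_nonneg_right h1 (show 0 ≤ f v - f z by linarith)
    have q2 := mul_le_mul_of_nonneg_right h2 (show 0 ≤ f z - f u by linarith)
    have q3 : (f z - f u) * (f v - f z) ≤ (f v - f u) ^ 2 / 4 := by
      nlinarith [sq_nonneg ((f z - f u) - (f v - f z))]
    have q4 := mul_le_mul_of_nonneg_left q3 hrr'
    linarith
  · have q1 := mul_le_mul_of_nonneg_left h1 (show 0 ≤ v - u by linarith)
    have q2 := mul_le_mul_of_nonneg_left h3 (show 0 ≤ z - u by linarith)
    have q3 : (z - u) * ((r - r') * (f v - f u)) ≤ (v - u) * ((r - r') * (f v - f u)) :=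
      mul_le_mul_of_nonneg_right (by linarith) (mul_nonneg hrr' (by linarith))
    linarith

lemma hasChordControl_of_convex_monotone {f : ℝ → ℝ} {a b p R s w0 A α : ℝ} {K : ℕ}
    (hab : a < b) (hK : 1 ≤ K)
    (hcont : ContinuousOn f (Set.Icc a b)) (hfm : MonotoneOn f (Set.Icc a b))
    (hcvx : ConvexOn ℝ (Set.Icc a b) f) (hs : 0 < s) (hps : p ≤ s) (hR0 : 0 ≤ R)
    (hRs : R * s ≤ 1)
    (hp : ∀ u ∈ Set.Icc a b, ∀ v ∈ Set.Icc a b, u < v → p * (v - u) ≤ |f v - f u|)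
    (hR : ∀ u ∈ Set.Icc a b, ∀ v ∈ Set.Icc a b, u < v → R * |f v - f u| ≤ v - u)
    (hw0 : 0 ≤ w0) (hA : 0 ≤ A) (hα : α ∈ Set.Ioc (0 : ℝ) 1) :
    HasChordControl f a b (2 * K - 1) (fun u => w0 + A * u ^ α / (b - a) ^ α)
      ((s - p) * (b - a) / (4 * K ^ 2))
      (|f b - f a| * w0 + A / (b - a) ^ α * ((|f b - f a| / K) ^ (1 + α) * (1 / 4) ^ α)
        * (((1 / s) ^ α - R ^ α) / α)) := by
  have hK0 : (0 : ℝ) < K := by exact_mod_cast hK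
  have hba : 0 < b - a := sub_pos.2 hab
  have haI : a ∈ Set.Icc a b := Set.left_mem_Icc.2 hab.le
  have hbI : b ∈ Set.Icc a b := Set.right_mem_Icc.2 hab.le
  have hfab : f a ≤ f b := hfm haI hbI hab.le
  rw [abs_of_nonneg (sub_nonneg.2 hfab)]
  have habs : ∀ u ∈ Set.Icc a b, ∀ v ∈ Set.Icc a b, u < v → |f v - f u| = f v - f u :=
    fun u hu v hv huv => abs_of_nonneg (sub_nonneg.2 (hfm hu hv huv.le))
  have hex : ∀ x, ∃ m : ℝ, x ∈ Set.Ioo a b → ∀ z ∈ Set.Icc a b, f x + m * (z - x) ≤ f z := by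
    intro x
    by_cases hx : x ∈ Set.Ioo a b
    · obtain ⟨m, hm⟩ := exists_subgradient hcvx hx
      exact ⟨m, fun _ => hm⟩
    · exact ⟨0, fun h => absurd h hx⟩
  choose m hm using hex
  have hIoo : Set.Ioo a b ⊆ Set.Icc a b := Set.Ioo_subset_Icc_self
  have hmm : MonotoneOn m (Set.Ioo a b) := by
    intro x hx y hy hxy
    rcases hxy.eq_or_lt with rfl | hxy
    · exact le_rfl
    have h1 := hm x hx y (hIoo hy)
    have h2 := hm y hy x (hIoo hx)
    nlinarith
  have hpm : ∀ x ∈ Set.Ioo a b, p ≤ m x := by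
    intro x hx
    have h1 := hm x hx a haI
    have h2 := hp a haI x (hIoo hx) hx.1
    rw [habs a haI x (hIoo hx) hx.1] at h2
    nlinarith [hx.1]
  obtain ⟨c, hc, hmc, hcm⟩ := exists_level_cut hab.le hmm s
  obtain ⟨S₁, hcard₁, hS₁, hpc₁⟩ := exists_nodes_of_slope_le hK hcont hcvx hc hps hm hmm hpm hmc
  obtain ⟨r, r_anti, r_nonneg, r_pos, r_a, r_b, r_slope⟩ := exists_inverse_slope hcont hfm hc hs
    hR0 hRs (fun z hz => by
      rcases hz.2.eq_or_lt with rfl | hzb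
      · simp
      · have := hR z hz b hbI hzb
        rwa [habs z hz b hbI hzb] at this) hm hcm
  have hcb : Set.Icc c b ⊆ Set.Icc a b := Set.Icc_subset_Icc_left hc.1
  have hac : f a ≤ f c := hfm haI hc hc.1
  have hfcb : f c ≤ f b := hfm hc hbI hc.2
  obtain ⟨S₂, hcard₂, hS₂, hosc⟩ := exists_oscillation_cuts (G := f) (a := c) (b := b) hc.2
    (hfm.mono (Set.Ioo_subset_Icc_self.trans hcb)) hK (lo := f c) (h := (f b - f c) / K)
    (fun x hx => hfm hc (hcb (Set.Ioo_subset_Icc_self hx)) hx.1.le)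
    (fun x hx => by
      rw [mul_div_cancel₀ _ hK0.ne']
      linarith [hfm (hcb (Set.Ioo_subset_Icc_self hx)) hbI hx.2.le])
  set H := (f b - f a) / K with hH
  have hH0 : 0 ≤ H := div_nonneg (by linarith) hK0.le
  set C := A / (b - a) ^ α * (H ^ (1 + α) * (1 / 4) ^ α) / α with hC
  have hα0 := hα.1
  have hC0 : 0 ≤ C := by positivity
  have Φ_mono : MonotoneOn (fun x => w0 * f (max x c) - C * r x ^ α) (Set.Icc a b) := by
    intro x hx y hy hxy
    have h1 : f (max x c) ≤ f (max y c) := hfm ⟨hx.1.trans (le_max_left _ _), max_le hx.2 hc.2⟩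
      ⟨hy.1.trans (le_max_left _ _), max_le hy.2 hc.2⟩ (max_le_max_right c hxy)
    have h2 : r y ^ α ≤ r x ^ α := Real.rpow_le_rpow (r_nonneg y) (r_anti hx hy hxy) hα0.le
    simp only
    gcongr
  refine ⟨insert c (S₁ ∪ S₂), ?_, ?_, _, Φ_mono, ?_, ?_⟩
  · have h1 := Finset.card_insert_le c (S₁ ∪ S₂)
    have h2 := Finset.card_union_le S₁ S₂
    omega
  · rw [Finset.coe_insert, Finset.coe_union]
    exact Set.insert_subset hc (Set.union_subset hS₁ (hS₂.trans hcb))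
  · simp only [max_eq_left hc.2, max_eq_right hc.1, r_a]
    have h1 : R ^ α ≤ r b ^ α := Real.rpow_le_rpow hR0 r_b hα0.le
    have h2 := mul_le_mul_of_nonneg_left h1 hC0
    have h3 := mul_le_mul_of_nonneg_left hac hw0
    have h4 : A / (b - a) ^ α * (H ^ (1 + α) * (1 / 4) ^ α) * (((1 / s) ^ α - R ^ α) / α)
        = C * (1 / s) ^ α - C * R ^ α := by
      rw [hC]; ring
    rw [h4]
    linarith
  intro u v hau huv hvb hav z hz
  have huI : u ∈ Set.Icc a b := ⟨hau, huv.le.trans hvb⟩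
  have hvI : v ∈ Set.Icc a b := ⟨hau.trans huv.le, hvb⟩
  have hl : 0 < v - u := sub_pos.2 huv
  have hw : 0 ≤ w0 + A * (v - u) ^ α / (b - a) ^ α := by positivity
  have hE : 0 ≤ (s - p) * (b - a) / (4 * K ^ 2) := by
    have := sub_nonneg.2 hps
    positivity
  rcases le_or_gt v c with hvc | hcv
  · have h1 := hpc₁ u v hau huv hvc (fun x hx => hav x (by simp [hx])) z hz
    have h2 : (s - p) * (c - a) / (4 * (K : ℝ) ^ 2) ≤ (s - p) * (b - a) / (4 * K ^ 2) := by
      have := sub_nonneg.2 hps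
      have := hc.2
      gcongr
    have h3 := Φ_mono huI hvI huv.le
    exact (mul_nonpos_of_nonpos_of_nonneg (by linarith) hw).trans (sub_nonneg.2 h3)
  have hcu : c ≤ u := by
    by_contra! hlt
    exact hav c (by simp) ⟨hlt, hcv⟩
  have huc : u ∈ Set.Icc c b := ⟨hcu, huI.2⟩
  have hvc : v ∈ Set.Icc c b := ⟨hcu.trans huv.le, hvb⟩
  have hzc : z ∈ Set.Icc c b := ⟨hcu.trans hz.1, hz.2.trans hvb⟩
  have hsubI : Set.Icc u v ⊆ Set.Icc a b := Set.Icc_subset_Icc hau hvb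
  have rr := r_anti huI hvI huv.le
  have hfuv : f u ≤ f v := hfm huI hvI huv.le
  have hHuv : f v - f u ≤ H := by
    have key : ∀ q ∈ Set.Ioo u v ×ˢ Set.Ioo u v, f q.2 - f q.1 ≤ (f b - f c) / K := by
      rintro ⟨x, x'⟩ ⟨hx, hx'⟩
      rcases le_total x x' with h | h
      · exact hosc u v hcu hvb (fun y hy => hav y (by simp [hy])) x hx x' hx' h
      · have h1 := hfm (hsubI (Set.Ioo_subset_Icc_self hx'))
          (hsubI (Set.Ioo_subset_Icc_self hx)) h
        have h2 : 0 ≤ (f b - f c) / K := div_nonneg (by linarith) hK0.le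
        simp only
        linarith
    have hcl : closure (Set.Ioo u v ×ˢ Set.Ioo u v) = Set.Icc u v ×ˢ Set.Icc u v := by
      rw [closure_prod_eq, closure_Ioo huv.ne]
    have c0 := hcont.mono hsubI
    have c1 : ContinuousOn (fun q : ℝ × ℝ => f q.2 - f q.1) (Set.Icc u v ×ˢ Set.Icc u v) :=
      (c0.comp continuousOn_snd fun q hq => hq.2).sub
        (c0.comp continuousOn_fst fun q hq => hq.1)
    have h1 := le_on_closure key (by rwa [hcl]) continuousOn_const (x := (u, v))
      (by rw [hcl]; exact ⟨Set.left_mem_Icc.2 huv.le, Set.right_mem_Icc.2 huv.le⟩)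
    refine h1.trans ?_
    rw [hH]
    gcongr
  obtain ⟨g1, g2, g3⟩ := chord_gap_le_of_inverse_slope (hfm.mono hsubI) hz rr
    (r_slope u huc z hzc) (by linarith [r_slope v hvc z hzc]) (by linarith [r_slope v hvc u huc])
  have g0 := chord_gap_nonneg (hcvx.subset hsubI (convex_Icc u v)) hz
  set N := (v - z) * (f u - f z) + (z - u) * (f v - f z) with hN
  have hNe : chordErr f u v z * (v - u) = N := by
    rw [chordErr, abs_of_nonneg g0, div_mul_cancel₀ _ hl.ne']
  have he : 0 ≤ chordErr f u v z := by rw [chordErr]; positivity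
  set e := chordErr f u v z
  have hrr : 0 ≤ r u - r v := sub_nonneg.2 rr
  have b1 : e ≤ f v - f u := le_of_mul_le_mul_right (by linarith) hl
  have b2 : e * (v - u) ≤ (r u - r v) * (H ^ 2 / 4) := by
    rw [hNe]
    refine g2.trans ?_
    gcongr
  have b3 : e * r u ≤ (r u - r v) * H := by
    have h1 : e * r u ≤ (r u - r v) * (f v - f u) := by
      refine le_of_mul_le_mul_right ?_ hl
      calc e * r u * (v - u) = N * r u := by rw [← hNe]; ring
        _ ≤ _ := by linarith
    exact h1.trans (mul_le_mul_of_nonneg_left hHuv hrr)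
  have b4 := chord_gap_mul_rpow_le hα he hl hH0 (r_pos u (huv.trans_le hvb)) (r_nonneg v) rr b3 b2
  have b5 := mul_le_mul_of_nonneg_left b4 (show 0 ≤ A / (b - a) ^ α by positivity)
  have b6 := mul_le_mul_of_nonneg_left b1 hw0
  have b7 := mul_nonneg hE hw
  simp only [max_eq_left hcu, max_eq_left hvc.1]
  have e1 : A / (b - a) ^ α * (H ^ (1 + α) * (1 / 4) ^ α * ((r u ^ α - r v ^ α) / α))
      = C * r u ^ α - C * r v ^ α := by
    rw [hC]; ring
  have e2 : e * (w0 + A * (v - u) ^ α / (b - a) ^ α)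
      = w0 * e + A / (b - a) ^ α * (e * (v - u) ^ α) := by ring
  rw [e1] at b5
  rw [sub_mul, e2]
  linarith

lemma HasChordControl.neg {f : ℝ → ℝ} {a b : ℝ} {n : ℕ} {w : ℝ → ℝ} {E B : ℝ}
    (h : HasChordControl f a b n w E B) : HasChordControl (fun x => -f x) a b n w E B := by
  obtain ⟨S, h1, h2, Φ, h3, h4, h5⟩ := h
  refine ⟨S, h1, h2, Φ, h3, h4, fun u v hau huv hvb hav z hz => ?_⟩
  have : chordErr (fun x => -f x) u v z = chordErr f u v z := by
    rw [chordErr, chordErr, ← abs_neg]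
    congr 2
    ring
  rw [this]
  exact h5 u v hau huv hvb hav z hz

lemma HasChordControl.reflect {f : ℝ → ℝ} {a b : ℝ} {n : ℕ} {w : ℝ → ℝ} {E B : ℝ}
    (h : HasChordControl f a b n w E B) :
    HasChordControl (fun x => f (a + b - x)) a b n w E B := by
  obtain ⟨S, h1, h2, Φ, h3, h4, h5⟩ := h
  have hI : ∀ x ∈ Set.Icc a b, a + b - x ∈ Set.Icc a b := fun x hx =>
    ⟨by linarith [hx.2], by linarith [hx.1]⟩
  refine ⟨S.image (fun x => a + b - x), Finset.card_image_le.trans h1, ?_,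
    fun x => -Φ (a + b - x), ?_, ?_, fun u v hau huv hvb hav z hz => ?_⟩
  · intro x hx
    simp only [Finset.coe_image, Set.mem_image] at hx
    obtain ⟨y, hy, rfl⟩ := hx
    exact hI y (h2 hy)
  · intro x hx y hy hxy
    exact neg_le_neg (h3 (hI y hy) (hI x hx) (by linarith))
  · simp only [add_sub_cancel_left, add_sub_cancel_right]
    linarith
  · have e : chordErr (fun x => f (a + b - x)) u v z
        = chordErr f (a + b - v) (a + b - u) (a + b - z) := by
      simp only [chordErr]
      rw [show a + b - u - (a + b - z) = z - u by ring,
        show a + b - z - (a + b - v) = v - z by ring,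
        show a + b - u - (a + b - v) = v - u by ring, add_comm]
    have := h5 (a + b - v) (a + b - u) (by linarith) (by linarith) (by linarith)
      (fun x hx hxm => hav (a + b - x) (Finset.mem_image_of_mem _ hx)
        ⟨by linarith [hxm.2], by linarith [hxm.1]⟩) (a + b - z)
      ⟨by linarith [hz.2], by linarith [hz.1]⟩
    rw [show a + b - u - (a + b - v) = v - u by ring] at this
    rw [e]
    linarith

lemma hasChordControl_of_monotone_convex_or {f : ℝ → ℝ} {a b p R s w0 A α : ℝ} {K : ℕ}
    (hab : a < b) (hK : 1 ≤ K)
    (hcont : ContinuousOn f (Set.Icc a b))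
    (hmono : MonotoneOn f (Set.Icc a b) ∨ AntitoneOn f (Set.Icc a b))
    (hcvx : ConvexOn ℝ (Set.Icc a b) f ∨ ConcaveOn ℝ (Set.Icc a b) f)
    (hs : 0 < s) (hps : p ≤ s) (hR0 : 0 ≤ R) (hRs : R * s ≤ 1)
    (hp : ∀ u ∈ Set.Icc a b, ∀ v ∈ Set.Icc a b, u < v → p * (v - u) ≤ |f v - f u|)
    (hR : ∀ u ∈ Set.Icc a b, ∀ v ∈ Set.Icc a b, u < v → R * |f v - f u| ≤ v - u)
    (hw0 : 0 ≤ w0) (hA : 0 ≤ A) (hα : α ∈ Set.Ioc (0 : ℝ) 1) :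
    HasChordControl f a b (2 * K - 1) (fun u => w0 + A * u ^ α / (b - a) ^ α)
      ((s - p) * (b - a) / (4 * K ^ 2))
      (|f b - f a| * w0 + A / (b - a) ^ α * ((|f b - f a| / K) ^ (1 + α) * (1 / 4) ^ α)
        * (((1 / s) ^ α - R ^ α) / α)) := by
  have anti : ∀ g : ℝ → ℝ, ContinuousOn g (Set.Icc a b) → AntitoneOn g (Set.Icc a b) →
      ConvexOn ℝ (Set.Icc a b) g →
      (∀ u ∈ Set.Icc a b, ∀ v ∈ Set.Icc a b, u < v → p * (v - u) ≤ |g v - g u|) →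
      (∀ u ∈ Set.Icc a b, ∀ v ∈ Set.Icc a b, u < v → R * |g v - g u| ≤ v - u) →
      HasChordControl g a b (2 * K - 1) (fun u => w0 + A * u ^ α / (b - a) ^ α)
        ((s - p) * (b - a) / (4 * K ^ 2))
        (|g b - g a| * w0 + A / (b - a) ^ α * ((|g b - g a| / K) ^ (1 + α) * (1 / 4) ^ α)
          * (((1 / s) ^ α - R ^ α) / α)) := by
    intro g gc gm gv gp gR
    have hI : ∀ x ∈ Set.Icc a b, a + b - x ∈ Set.Icc a b := fun x hx =>
      ⟨by linarith [hx.2], by linarith [hx.1]⟩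
    have gc' : ContinuousOn (fun x => g (a + b - x)) (Set.Icc a b) :=
      gc.comp (by fun_prop) hI
    have gm' : MonotoneOn (fun x => g (a + b - x)) (Set.Icc a b) := fun x hx y hy hxy =>
      gm (hI y hy) (hI x hx) (by linarith)
    have gv' : ConvexOn ℝ (Set.Icc a b) (fun x => g (a + b - x)) := by
      refine ⟨convex_Icc a b, fun x hx y hy t t' ht ht' htt => ?_⟩
      have := gv.2 (hI x hx) (hI y hy) ht ht' htt
      refine le_trans (le_of_eq ?_) this
      simp only [smul_eq_mul]
      congr 1
      have : t' = 1 - t := by linarith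
      subst this
      ring
    have key := hasChordControl_of_convex_monotone hab hK gc' gm' gv' hs hps hR0 hRs
      (fun u hu v hv huv => by
        have := gp _ (hI v hv) _ (hI u hu) (by linarith)
        rw [abs_sub_comm] at this
        linarith)
      (fun u hu v hv huv => by
        have := gR _ (hI v hv) _ (hI u hu) (by linarith)
        rw [abs_sub_comm] at this
        linarith) hw0 hA hα
    have key' := key.reflect
    simp only [sub_sub_cancel, add_sub_cancel_left, add_sub_cancel_right] at key'
    rwa [abs_sub_comm] at key'
  have np : ∀ u v, |(-f v) - (-f u)| = |f v - f u| := fun u v => by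
    rw [← abs_neg]; congr 1; ring
  rcases hcvx with hv | hv <;> rcases hmono with hm | hm
  · exact hasChordControl_of_convex_monotone hab hK hcont hm hv hs hps hR0 hRs hp hR hw0 hA hα
  · exact anti f hcont hm hv hp hR
  · have := (anti (fun x => -f x) hcont.neg hm.neg hv.neg
      (by simpa only [np] using hp) (by simpa only [np] using hR)).neg
    simpa only [np, neg_neg] using this
  · have := (hasChordControl_of_convex_monotone (f := fun x => -f x) hab hK hcont.neg hm.neg hv.neg
      hs hps hR0 hRs (by simpa only [np] using hp) (by simpa only [np] using hR) hw0 hA hα).neg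
    simpa only [np, neg_neg] using this

/-- A finite set of at most `N - 1` points of `[a, b]` can be completed to a subdivision of `[a, b]`
into `N` intervals. -/
lemma exists_subdivision {a b : ℝ} (hab : a < b) {N : ℕ} (hN : 1 ≤ N) {S : Finset ℝ}
    (hcard : S.card ≤ N - 1) (hS : ↑S ⊆ Set.Icc a b) :
    ∃ T : ℕ → ℝ, T 0 = a ∧ T N = b ∧ (∀ i < N, T i < T (i + 1)) ∧
      ∀ i < N, ∀ x ∈ S, x ∉ Set.Ioo (T i) (T (i + 1)) := by
  set S' : Finset ℝ := insert a (insert b S) with hS'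
  have hS'I : ∀ x ∈ S', x ∈ Set.Icc a b := by
    intro x hx
    simp only [hS', Finset.mem_insert] at hx
    rcases hx with rfl | rfl | hx
    exacts [Set.left_mem_Icc.2 hab.le, Set.right_mem_Icc.2 hab.le, hS hx]
  have hcard' : S'.card ≤ N + 1 := by
    have h1 : S'.card ≤ (insert b S).card + 1 := Finset.card_insert_le _ _
    have h2 := Finset.card_insert_le b S
    omega
  have hinf : (Set.Icc a b \ ↑S').Infinite := (Set.Icc_infinite hab).sdiff S'.finite_toSet
  obtain ⟨U, hU, hUcard⟩ := hinf.exists_subset_card_eq (N + 1 - S'.card)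
  have hdisj : Disjoint S' U := Finset.disjoint_left.2 fun x hx hxU => (hU hxU).2 hx
  have hWcard : (S' ∪ U).card = N + 1 := by
    rw [Finset.card_union_of_disjoint hdisj, hUcard]
    omega
  have hWI : ∀ x ∈ S' ∪ U, x ∈ Set.Icc a b := by
    intro x hx
    rcases Finset.mem_union.1 hx with hx | hx
    exacts [hS'I x hx, (hU hx).1]
  have haW : a ∈ S' ∪ U := by simp [hS']
  have hbW : b ∈ S' ∪ U := by simp [hS']
  set τ := (S' ∪ U).orderEmbOfFin hWcard with hτ
  have hrange : ∀ x ∈ S' ∪ U, ∃ j, τ j = x := by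
    intro x hx
    have : x ∈ Set.range τ := by rw [hτ, Finset.range_orderEmbOfFin]; exact hx
    exact this
  have hmem : ∀ j, τ j ∈ Set.Icc a b := fun j => hWI _ (Finset.orderEmbOfFin_mem _ _ j)
  refine ⟨fun n => τ ⟨min n N, by omega⟩, ?_, ?_, ?_, ?_⟩
  · obtain ⟨j, hj⟩ := hrange a haW
    refine le_antisymm ?_ (hmem _).1
    exact (τ.monotone (Fin.le_def.2 (by simp))).trans_eq hj
  · obtain ⟨j, hj⟩ := hrange b hbW
    refine le_antisymm (hmem _).2 ?_
    exact hj.ge.trans (τ.monotone (Fin.le_def.2 (by simp; omega)))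
  · intro i hi
    exact τ.strictMono (Fin.lt_def.2 (by simp; omega))
  · intro i hi x hx hxm
    obtain ⟨j, rfl⟩ := hrange x (by simp [hS', hx])
    have h1 := Fin.lt_def.1 (τ.strictMono.lt_iff_lt.1 hxm.1)
    have h2 := Fin.lt_def.1 (τ.strictMono.lt_iff_lt.1 hxm.2)
    simp only at h1 h2
    omega

lemma exists_interpolation (f : ℝ → ℝ) {T : ℕ → ℝ} {N : ℕ} (hT : ∀ i < N, T i < T (i + 1)) :
    ∃ l : ℝ → ℝ, ∀ i < N, ∀ y ∈ Set.Icc (T i) (T (i + 1)),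
      l y = f (T i) + (f (T (i + 1)) - f (T i)) / (T (i + 1) - T i) * (y - T i) := by
  suffices h : ∃ l : ℝ → ℝ, l (T N) = f (T N) ∧ ∀ i < N, ∀ y ∈ Set.Icc (T i) (T (i + 1)),
      l y = f (T i) + (f (T (i + 1)) - f (T i)) / (T (i + 1) - T i) * (y - T i) from
    let ⟨l, _, hl⟩ := h
    ⟨l, hl⟩
  induction N with
  | zero => exact ⟨f, rfl, fun i hi => absurd hi (Nat.not_lt_zero i)⟩
  | succ N ih =>
    obtain ⟨l, hlN, hl⟩ := ih fun i hi => hT i (by omega)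
    have hmono : ∀ j ≤ N, T j ≤ T N := by
      intro j hj
      refine Nat.decreasingInduction (motive := fun k _ => T k ≤ T N) (fun k hk hle => ?_) le_rfl hj
      exact (hT k (by omega)).le.trans hle
    have hN := hT N (by omega)
    refine ⟨fun y => if y ≤ T N then l y else
      f (T N) + (f (T (N + 1)) - f (T N)) / (T (N + 1) - T N) * (y - T N), ?_, ?_⟩
    · simp only [if_neg hN.not_ge]
      rw [div_mul_cancel₀ _ (sub_pos.2 hN).ne']
      ring
    · intro i hi y hy
      rcases Nat.lt_succ_iff_lt_or_eq.1 hi with hi | rfl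
      · simp only [if_pos (hy.2.trans (hmono (i + 1) (by omega)))]
        exact hl i hi y hy
      · by_cases h : y ≤ T i
        · obtain rfl : y = T i := le_antisymm h hy.1
          simp [hlN]
        · simp only [if_neg h]

/-- Chord control yields a piecewise linear interpolation with small integrated error. -/
lemma HasChordControl.exists_interp {f : ℝ → ℝ} {a b : ℝ} {N : ℕ} {w : ℝ → ℝ} {E B : ℝ}
    (h : HasChordControl f a b (N - 1) w E B) (hab : a < b) (hN : 1 ≤ N) (hE : 0 ≤ E)
    (hw : ∀ u, 0 < u → 0 < w u)
    (Q : Measure ℝ) [IsProbabilityMeasure Q]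
    (hQ : ∀ u v, u < v → Q (Set.Ioc u v) ≤ ENNReal.ofReal (w (v - u))) :
    ∃ l : ℝ → ℝ, IsLinearInterp f a b N l ∧
      ∫⁻ y in Set.Icc a b, ENNReal.ofReal |f y - l y| ∂Q ≤ ENNReal.ofReal (E + B) := by
  obtain ⟨S, hcard, hS, Φ, hΦ, hB, hctrl⟩ := h
  obtain ⟨T, hT0, hTN, hT, hgap⟩ := exists_subdivision hab hN hcard hS
  obtain ⟨l, hl⟩ := exists_interpolation f hT
  have hmono : ∀ i j, i ≤ j → j ≤ N → T i ≤ T j := by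
    intro i j hij
    induction j, hij using Nat.le_induction with
    | base => exact fun _ => le_rfl
    | succ k _ ih => exact fun hk => (ih (by omega)).trans (hT k (by omega)).le
  have hTa : ∀ i ≤ N, a ≤ T i := fun i hi => hT0 ▸ hmono 0 i (Nat.zero_le i) hi
  have hTb : ∀ i ≤ N, T i ≤ b := fun i hi => hTN ▸ hmono i N hi le_rfl
  refine ⟨l, ⟨fun i => T i, hT0, by simpa using hTN, ?_, ?_⟩, ?_⟩
  · exact Fin.strictMono_iff_lt_succ.2 fun i => by simpa using hT i i.2
  · intro i y hy
    simp only [Fin.val_castSucc, Fin.val_succ] at hy ⊢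
    exact hl i i.2 y hy
  have piece : ∀ i < N, ∫⁻ y in Set.Ioc (T i) (T (i + 1)), ENNReal.ofReal |f y - l y| ∂Q ≤
      ENNReal.ofReal E * Q (Set.Ioc (T i) (T (i + 1)))
        + ENNReal.ofReal (Φ (T (i + 1)) - Φ (T i)) := by
    intro i hi
    have hlt := hT i hi
    have hpos := hw _ (sub_pos.2 hlt)
    have hd : 0 ≤ Φ (T (i + 1)) - Φ (T i) := sub_nonneg.2
      (hΦ ⟨hTa i hi.le, hTb i hi.le⟩ ⟨hTa _ hi, hTb _ hi⟩ hlt.le)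
    set d := Φ (T (i + 1)) - Φ (T i)
    calc ∫⁻ y in Set.Ioc (T i) (T (i + 1)), ENNReal.ofReal |f y - l y| ∂Q
        ≤ ∫⁻ _ in Set.Ioc (T i) (T (i + 1)),
            ENNReal.ofReal (E + d / w (T (i + 1) - T i)) ∂Q := by
          refine setLIntegral_mono' measurableSet_Ioc fun y hy => ENNReal.ofReal_le_ofReal ?_
          have hyI : y ∈ Set.Icc (T i) (T (i + 1)) := ⟨hy.1.le, hy.2⟩
          rw [hl i hi y hyI, abs_sub_chord_eq hlt]
          have := hctrl _ _ (hTa i hi.le) hlt (hTb _ hi) (hgap i hi) y hyI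
          rw [← le_div_iff₀ hpos] at this
          linarith
      _ = (ENNReal.ofReal E + ENNReal.ofReal (d / w (T (i + 1) - T i)))
            * Q (Set.Ioc (T i) (T (i + 1))) := by
          rw [setLIntegral_const, ENNReal.ofReal_add hE (div_nonneg hd hpos.le)]
      _ ≤ _ := by
          rw [add_mul]
          gcongr
          calc _ ≤ ENNReal.ofReal (d / w (T (i + 1) - T i))
                * ENNReal.ofReal (w (T (i + 1) - T i)) := by gcongr; exact hQ _ _ hlt
            _ = _ := by
              rw [← ENNReal.ofReal_mul (div_nonneg hd hpos.le), div_mul_cancel₀ _ hpos.ne']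
  have main : ∀ n ≤ N, ∫⁻ y in Set.Icc a (T n), ENNReal.ofReal |f y - l y| ∂Q ≤
      ENNReal.ofReal E * Q (Set.Icc a (T n)) + ENNReal.ofReal (Φ (T n) - Φ a) := by
    intro n
    induction n with
    | zero =>
      intro _
      have h0 : ∫⁻ y in Set.Icc a (T 0), ENNReal.ofReal |f y - l y| ∂Q = 0 := by
        rw [hT0, Set.Icc_self, lintegral_singleton]
        have := hl 0 hN a (by rw [hT0]; exact ⟨le_rfl, hT0 ▸ (hT 0 hN).le⟩)
        rw [this, hT0]
        simp
      rw [h0]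
      exact zero_le
    | succ n ih =>
      intro hn
      have ih := ih (by omega)
      have hp := piece n hn
      have hle := (hT n hn).le
      have ha := hTa n (by omega)
      have hdisj : Disjoint (Set.Icc a (T n)) (Set.Ioc (T n) (T (n + 1))) :=
        Set.disjoint_left.2 fun x hx hx' => hx.2.not_gt hx'.1
      rw [← Set.Icc_union_Ioc_eq_Icc ha hle, lintegral_union measurableSet_Ioc hdisj,
        measure_union hdisj measurableSet_Ioc]
      refine (add_le_add ih hp).trans (le_of_eq ?_)
      have d1 : 0 ≤ Φ (T n) - Φ a := sub_nonneg.2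
        (hΦ (Set.left_mem_Icc.2 hab.le) ⟨ha, hTb n (by omega)⟩ ha)
      have d2 : 0 ≤ Φ (T (n + 1)) - Φ (T n) := sub_nonneg.2
        (hΦ ⟨ha, hTb n (by omega)⟩ ⟨ha.trans hle, hTb _ hn⟩ hle)
      rw [show Φ (T (n + 1)) - Φ a = (Φ (T n) - Φ a) + (Φ (T (n + 1)) - Φ (T n)) by ring,
        ENNReal.ofReal_add d1 d2]
      ring
  have hfin := main N le_rfl
  rw [hTN] at hfin
  have hd : 0 ≤ Φ b - Φ a := sub_nonneg.2
    (hΦ (Set.left_mem_Icc.2 hab.le) (Set.right_mem_Icc.2 hab.le) hab.le)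
  calc _ ≤ _ := hfin
    _ ≤ ENNReal.ofReal E * 1 + ENNReal.ofReal B := by
        gcongr
        exact prob_le_one
    _ = ENNReal.ofReal (E + B) := by
        rw [mul_one, ENNReal.ofReal_add hE (hd.trans hB)]

lemma EReal.abs_le_abs_of_nonneg {x y : EReal} (hx : 0 ≤ x) (hxy : x ≤ y) : x.abs ≤ y.abs := by
  have coe_abs : ∀ z : EReal, 0 ≤ z → (z.abs : EReal) = z := by
    intro z hz
    induction z with
    | bot => simp at hz
    | top => simp
    | coe z => rw [EReal.coe_abs, abs_of_nonneg (EReal.coe_nonneg.1 hz)]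
  rwa [← EReal.coe_ennreal_le_coe_ennreal_iff, coe_abs x hx, coe_abs y (hx.trans hxy)]

lemma EReal.abs_le_abs_of_nonpos {x y : EReal} (hy : y ≤ 0) (hxy : x ≤ y) : y.abs ≤ x.abs := by
  rw [← EReal.abs_neg x, ← EReal.abs_neg y]
  exact EReal.abs_le_abs_of_nonneg (EReal.neg_nonneg.2 hy) (EReal.neg_le_neg_iff.2 hxy)

section OneSidedDerivatives

variable {f : ℝ → ℝ} {a b : ℝ} {dra dlb : EReal}

/-- The chord slopes of a convex function lie between its one-sided derivatives at the end points. -/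
lemma ConvexOn.slope_mem_Icc_of_tendsto (hf : ConvexOn ℝ (Set.Icc a b) f)
    (hdra : Tendsto (fun y => (((f y - f a) / (y - a) : ℝ) : EReal))
      (nhdsWithin a (Set.Ioi a)) (nhds dra))
    (hdlb : Tendsto (fun y => (((f b - f y) / (b - y) : ℝ) : EReal))
      (nhdsWithin b (Set.Iio b)) (nhds dlb))
    {u v : ℝ} (hu : a ≤ u) (huv : u < v) (hv : v ≤ b) :
    (((f v - f u) / (v - u) : ℝ) : EReal) ∈ Set.Icc dra dlb := by
  have flip : ∀ x y, (f x - f y) / (x - y) = (f y - f x) / (y - x) := fun x y => by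
    rw [← neg_sub (f y), ← neg_sub y, neg_div_neg_eq]
  have haI : a ∈ Set.Icc a b := ⟨le_rfl, hu.trans (huv.le.trans hv)⟩
  have hbI : b ∈ Set.Icc a b := ⟨hu.trans (huv.le.trans hv), le_rfl⟩
  have huI : u ∈ Set.Icc a b := ⟨hu, huv.le.trans hv⟩
  have hvI : v ∈ Set.Icc a b := ⟨hu.trans huv.le, hv⟩
  constructor
  · refine le_of_tendsto hdra ?_
    filter_upwards [Ioo_mem_nhdsGT (hu.trans_lt huv)] with y hy
    refine EReal.coe_le_coe_iff.2 ?_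
    have h1 := hf.secant_mono haI ⟨hy.1.le, hy.2.le.trans hv⟩ hvI hy.1.ne'
      (hu.trans_lt huv).ne' hy.2.le
    have h2 := hf.secant_mono hvI haI huI (hu.trans_lt huv).ne huv.ne hu
    rw [flip a v, flip u v] at h2
    exact h1.trans h2
  · refine ge_of_tendsto hdlb ?_
    filter_upwards [Ioo_mem_nhdsLT (huv.trans_le hv)] with y hy
    refine EReal.coe_le_coe_iff.2 ?_
    have h1 := hf.secant_mono huI hvI hbI huv.ne' (huv.trans_le hv).ne' hv
    have h2 := hf.secant_mono hbI huI ⟨hu.trans hy.1.le, hy.2.le⟩ (huv.trans_le hv).ne hy.2.ne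
      hy.1.le
    rw [flip u b, flip y b] at h2
    exact h1.trans h2

lemma ConcaveOn.slope_mem_Icc_of_tendsto (hf : ConcaveOn ℝ (Set.Icc a b) f)
    (hdra : Tendsto (fun y => (((f y - f a) / (y - a) : ℝ) : EReal))
      (nhdsWithin a (Set.Ioi a)) (nhds dra))
    (hdlb : Tendsto (fun y => (((f b - f y) / (b - y) : ℝ) : EReal))
      (nhdsWithin b (Set.Iio b)) (nhds dlb))
    {u v : ℝ} (hu : a ≤ u) (huv : u < v) (hv : v ≤ b) :
    (((f v - f u) / (v - u) : ℝ) : EReal) ∈ Set.Icc dlb dra := by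
  have e : ∀ x y, (((-f) x - (-f) y) / (x - y) : ℝ) = -((f x - f y) / (x - y)) := fun x y => by
    simp only [Pi.neg_apply]
    ring
  have key := ConvexOn.slope_mem_Icc_of_tendsto (dra := -dra) (dlb := -dlb) hf.neg
    (by simpa only [e, EReal.coe_neg] using hdra.neg)
    (by simpa only [e, EReal.coe_neg] using hdlb.neg) hu huv hv
  rw [e, EReal.coe_neg] at key
  exact ⟨EReal.neg_le_neg_iff.1 key.2, EReal.neg_le_neg_iff.1 key.1⟩

/-- The absolute chord slopes of a monotone convex or concave function lie between the smallest and
the largest absolute one-sided derivative at the end points. -/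
lemma abs_slope_mem_Icc_of_tendsto
    (hmono : MonotoneOn f (Set.Icc a b) ∨ AntitoneOn f (Set.Icc a b))
    (hcvx : ConvexOn ℝ (Set.Icc a b) f ∨ ConcaveOn ℝ (Set.Icc a b) f)
    (hdra : Tendsto (fun y => (((f y - f a) / (y - a) : ℝ) : EReal))
      (nhdsWithin a (Set.Ioi a)) (nhds dra))
    (hdlb : Tendsto (fun y => (((f b - f y) / (b - y) : ℝ) : EReal))
      (nhdsWithin b (Set.Iio b)) (nhds dlb))
    {u v : ℝ} (hu : a ≤ u) (huv : u < v) (hv : v ≤ b) :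
    ENNReal.ofReal |(f v - f u) / (v - u)| ∈
      Set.Icc (min dra.abs dlb.abs) (max dra.abs dlb.abs) := by
  have hab : a < b := hu.trans_lt (huv.trans_le hv)
  have haI : a ∈ Set.Icc a b := Set.left_mem_Icc.2 hab.le
  have hbI : b ∈ Set.Icc a b := Set.right_mem_Icc.2 hab.le
  rw [← EReal.abs_def]
  set σ : EReal := (((f v - f u) / (v - u) : ℝ) : EReal)
  have order : (dra ≤ σ ∧ σ ≤ dlb) ∨ (dlb ≤ σ ∧ σ ≤ dra) :=
    hcvx.imp (fun h => h.slope_mem_Icc_of_tendsto hdra hdlb hu huv hv)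
      (fun h => h.slope_mem_Icc_of_tendsto hdra hdlb hu huv hv)
  rcases hmono with hm | hm
  · have ha : 0 ≤ dra := by
      refine ge_of_tendsto hdra ?_
      filter_upwards [Ioo_mem_nhdsGT hab] with y hy
      exact EReal.coe_nonneg.2 (div_nonneg
        (sub_nonneg.2 (hm haI ⟨hy.1.le, hy.2.le⟩ hy.1.le)) (sub_nonneg.2 hy.1.le))
    have hb : 0 ≤ dlb := by
      refine ge_of_tendsto hdlb ?_
      filter_upwards [Ioo_mem_nhdsLT hab] with y hy
      exact EReal.coe_nonneg.2 (div_nonneg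
        (sub_nonneg.2 (hm ⟨hy.1.le, hy.2.le⟩ hbI hy.2.le)) (sub_nonneg.2 hy.2.le))
    rcases order with ⟨h1, h2⟩ | ⟨h1, h2⟩
    · exact ⟨(min_le_left _ _).trans (EReal.abs_le_abs_of_nonneg ha h1),
        (EReal.abs_le_abs_of_nonneg (ha.trans h1) h2).trans (le_max_right _ _)⟩
    · exact ⟨(min_le_right _ _).trans (EReal.abs_le_abs_of_nonneg hb h1),
        (EReal.abs_le_abs_of_nonneg (hb.trans h1) h2).trans (le_max_left _ _)⟩
  · have ha : dra ≤ 0 := by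
      refine le_of_tendsto hdra ?_
      filter_upwards [Ioo_mem_nhdsGT hab] with y hy
      exact EReal.coe_nonpos.2 (div_nonpos_of_nonpos_of_nonneg
        (sub_nonpos.2 (hm haI ⟨hy.1.le, hy.2.le⟩ hy.1.le)) (sub_nonneg.2 hy.1.le))
    have hb : dlb ≤ 0 := by
      refine le_of_tendsto hdlb ?_
      filter_upwards [Ioo_mem_nhdsLT hab] with y hy
      exact EReal.coe_nonpos.2 (div_nonpos_of_nonpos_of_nonneg
        (sub_nonpos.2 (hm ⟨hy.1.le, hy.2.le⟩ hbI hy.2.le)) (sub_nonneg.2 hy.2.le))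
    rcases order with ⟨h1, h2⟩ | ⟨h1, h2⟩
    · exact ⟨(min_le_right _ _).trans (EReal.abs_le_abs_of_nonpos hb h2),
        (EReal.abs_le_abs_of_nonpos (h2.trans hb) h1).trans (le_max_left _ _)⟩
    · exact ⟨(min_le_left _ _).trans (EReal.abs_le_abs_of_nonpos ha h2),
        (EReal.abs_le_abs_of_nonpos (h2.trans ha) h1).trans (le_max_right _ _)⟩

end OneSidedDerivatives

/-- The linear index when the chord slope is nonzero. -/
lemma linIndex_eq {dra dlb : EReal} {Δ : ℝ} (hΔ : Δ ≠ 0) :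
    linIndex dra dlb Δ = 1 - (1 / 2) * ((min dra.abs dlb.abs).toReal / |Δ|
      + |Δ| * ((max dra.abs dlb.abs)⁻¹).toReal) := by
  have hpos : 0 < ENNReal.ofReal |Δ| := ENNReal.ofReal_pos.2 (abs_pos.2 hΔ)
  rw [linIndex, cdiv, cdiv, if_neg (fun h' => hpos.ne' h'.2), if_neg (fun h' => hpos.ne' h'.1),
    ENNReal.toReal_div, div_eq_mul_inv (ENNReal.ofReal _), ENNReal.toReal_mul,
    ENNReal.toReal_ofReal (abs_nonneg Δ)]

section Interpolation

variable {f : ℝ → ℝ} {a b w0 A α : ℝ} {Q : Measure ℝ} {K : ℕ}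

lemma IsModulus.measure_Ioc_le {w : ℝ → ℝ} (hw : IsModulus Q w) {u v : ℝ} (huv : u < v) :
    Q (Set.Ioc u v) ≤ ENNReal.ofReal (w (v - u)) := by
  have := hw.2.2.2 (Set.Ioc u v) Set.ordConnected_Ioc (Metric.isBounded_Ioc u v)
  rwa [Real.volume_Ioc, ENNReal.toReal_ofReal (sub_nonneg.2 huv.le)] at this

lemma IsModulus.zero_le (hw : IsModulus Q (fun u => w0 + A * u ^ α / (b - a) ^ α)) (hα : α ≠ 0) :
    0 ≤ w0 := by
  simpa [Real.zero_rpow hα] using hw.1 0 le_rfl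

lemma exists_interp_of_slope_bounds [IsProbabilityMeasure Q] {p R s : ℝ}
    (hab : a < b) (hK : 1 ≤ K) (hcont : ContinuousOn f (Set.Icc a b))
    (hmono : MonotoneOn f (Set.Icc a b) ∨ AntitoneOn f (Set.Icc a b))
    (hcvx : ConvexOn ℝ (Set.Icc a b) f ∨ ConcaveOn ℝ (Set.Icc a b) f)
    (hs : 0 < s) (hps : p ≤ s) (hR0 : 0 ≤ R) (hRs : R * s ≤ 1)
    (hp : ∀ u ∈ Set.Icc a b, ∀ v ∈ Set.Icc a b, u < v → p * (v - u) ≤ |f v - f u|)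
    (hR : ∀ u ∈ Set.Icc a b, ∀ v ∈ Set.Icc a b, u < v → R * |f v - f u| ≤ v - u)
    (hA : 0 < A) (hα : α ∈ Set.Ioc (0 : ℝ) 1)
    (hw : IsModulus Q (fun u => w0 + A * u ^ α / (b - a) ^ α)) :
    ∃ l : ℝ → ℝ, IsLinearInterp f a b (2 * K) l ∧
      ∫⁻ y in Set.Icc a b, ENNReal.ofReal |f y - l y| ∂Q ≤ ENNReal.ofReal
        ((s - p) * (b - a) / (4 * K ^ 2) + (|f b - f a| * w0 + A / (b - a) ^ α *
          ((|f b - f a| / K) ^ (1 + α) * (1 / 4) ^ α) * (((1 / s) ^ α - R ^ α) / α))) := by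
  have hw0 : 0 ≤ w0 := hw.zero_le hα.1.ne'
  have hba : 0 < b - a := sub_pos.2 hab
  have hsp : 0 ≤ s - p := sub_nonneg.2 hps
  exact (hasChordControl_of_monotone_convex_or hab hK hcont hmono hcvx hs hps hR0 hRs hp hR hw0
    hA.le hα).exists_interp hab (by omega) (by positivity) (fun u hu => by positivity) Q
    fun u v huv => hw.measure_Ioc_le huv

lemma exists_interp_of_const [IsProbabilityMeasure Q] (hab : a < b) (hK : 1 ≤ K)
    (hmono : MonotoneOn f (Set.Icc a b) ∨ AntitoneOn f (Set.Icc a b)) (hV : f b = f a) :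
    ∃ l : ℝ → ℝ, IsLinearInterp f a b (2 * K) l ∧
      ∫⁻ y in Set.Icc a b, ENNReal.ofReal |f y - l y| ∂Q ≤ 0 := by
  have haI : a ∈ Set.Icc a b := Set.left_mem_Icc.2 hab.le
  have hbI : b ∈ Set.Icc a b := Set.right_mem_Icc.2 hab.le
  have hconst : ∀ x ∈ Set.Icc a b, f x = f a := by
    intro x hx
    rcases hmono with hm | hm
    · exact le_antisymm ((hm hx hbI hx.2).trans_eq hV) (hm haI hx hx.1)
    · exact le_antisymm (hm haI hx hx.1) (hV.ge.trans (hm hx hbI hx.2))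
  have h : HasChordControl f a b (2 * K - 1) (fun _ => 1) 0 0 := by
    refine ⟨∅, by simp, by simp, fun _ => 0, monotoneOn_const, by simp,
      fun u v hau huv hvb _ z hz => ?_⟩
    rw [chordErr, hconst u ⟨hau, huv.le.trans hvb⟩, hconst v ⟨hau.trans huv.le, hvb⟩,
      hconst z ⟨hau.trans hz.1, hz.2.trans hvb⟩]
    simp
  simpa using h.exists_interp hab (by omega) le_rfl (fun _ _ => one_pos) Q
    fun _ _ _ => by simpa using prob_le_one

/-- Choosing the slope threshold that balances both contributions to the error. -/
lemma exists_interp_rpow [IsProbabilityMeasure Q] (hab : a < b) (hK : 1 ≤ K)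
    (hcont : ContinuousOn f (Set.Icc a b))
    (hmono : MonotoneOn f (Set.Icc a b) ∨ AntitoneOn f (Set.Icc a b))
    (hcvx : ConvexOn ℝ (Set.Icc a b) f ∨ ConcaveOn ℝ (Set.Icc a b) f)
    (hV : 0 < |f b - f a|) (hA : 0 < A) (hα : α ∈ Set.Ioc (0 : ℝ) 1)
    (hw : IsModulus Q (fun u => w0 + A * u ^ α / (b - a) ^ α)) :
    ∃ l : ℝ → ℝ, IsLinearInterp f a b (2 * K) l ∧
      ∫⁻ y in Set.Icc a b, ENNReal.ofReal |f y - l y| ∂Q ≤ ENNReal.ofReal (|f b - f a| *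
        (w0 + (2 ^ (1 - α) * A / (α * (K : ℝ) ^ (1 + 3 * α))) ^ (1 / (1 + α)))) := by
  have hα0 := hα.1
  have hK0 : (0 : ℝ) < K := by exact_mod_cast hK
  have hba : 0 < b - a := sub_pos.2 hab
  set V := |f b - f a|
  set X := 2 ^ (1 - α) * A / (α * (K : ℝ) ^ (1 + 3 * α)) with hX
  have hX0 : 0 < X := by positivity
  set T := X ^ (1 / (1 + α)) with hT
  have hT0 : 0 < T := by positivity
  have hTX : T * T ^ α = X := by
    rw [← Real.rpow_one_add' hT0.le (by positivity), hT, ← Real.rpow_mul hX0.le,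
      one_div_mul_cancel (by positivity), Real.rpow_one]
  obtain ⟨l, hl, hint⟩ := exists_interp_of_slope_bounds (p := 0) (R := 0)
    (s := 2 * T * (K : ℝ) ^ 2 * V / (b - a)) hab hK hcont hmono hcvx (by positivity)
    (by positivity) le_rfl (by simp) (fun _ _ _ _ _ => by simp)
    (fun _ _ _ _ huv => by simpa using huv.le) hA hα hw
  refine ⟨l, hl, hint.trans (ENNReal.ofReal_le_ofReal ?_)⟩
  have hq : ((1 : ℝ) / 4) ^ α ≤ 1 := Real.rpow_le_one (by norm_num) (by norm_num) hα0.le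
  set q := ((1 : ℝ) / 4) ^ α
  have e1 : (V / K) ^ (1 + α) = V * V ^ α / (K * (K : ℝ) ^ α) := by
    rw [Real.div_rpow hV.le hK0.le, Real.rpow_one_add' hV.le (by positivity),
      Real.rpow_one_add' hK0.le (by positivity)]
  have e2 : (1 / (2 * T * (K : ℝ) ^ 2 * V / (b - a))) ^ α
      = (b - a) ^ α / (2 ^ α * T ^ α * ((K : ℝ) ^ α) ^ 2 * V ^ α) := by
    rw [one_div_div, Real.div_rpow hba.le (by positivity), Real.mul_rpow (by positivity) hV.le,
      Real.mul_rpow (by positivity) (by positivity), Real.mul_rpow (by positivity) hT0.le,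
      Real.rpow_pow_comm hK0.le]
  have e3 : (K : ℝ) ^ (1 + 3 * α) = K * ((K : ℝ) ^ α) ^ 3 := by
    rw [Real.rpow_one_add' hK0.le (by positivity), mul_comm 3 α, Real.rpow_mul hK0.le]
    norm_cast
  have e4 : (2 : ℝ) ^ (1 - α) = 2 / 2 ^ α := by
    rw [Real.rpow_sub two_pos, Real.rpow_one]
  rw [hX, e3, e4] at hTX
  rw [e1, e2, Real.zero_rpow hα0.ne']
  have hLα : 0 < (b - a) ^ α := by positivity
  have hVα : 0 < V ^ α := by positivity
  have hTα : 0 < T ^ α := by positivity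
  have hKα : 0 < (K : ℝ) ^ α := by positivity
  have h2α : 0 < (2 : ℝ) ^ α := by positivity
  have hAeq : A = T * T ^ α * (α * (K * ((K : ℝ) ^ α) ^ 3)) * 2 ^ α / 2 := by
    rw [hTX]
    field_simp
  have e5 : A / (b - a) ^ α * (V * V ^ α / (K * (K : ℝ) ^ α) * q) *
      (((b - a) ^ α / (2 ^ α * T ^ α * ((K : ℝ) ^ α) ^ 2 * V ^ α) - 0) / α) = V * T / 2 * q := by
    rw [hAeq]
    field_simp
    ring
  have e6 : (2 * T * (K : ℝ) ^ 2 * V / (b - a) - 0) * (b - a) / (4 * K ^ 2) = V * T / 2 := by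
    field_simp
    ring
  rw [e5, e6]
  nlinarith [mul_le_mul_of_nonneg_left hq (show 0 ≤ V * T / 2 by positivity)]

lemma exists_interp_linIndex [IsProbabilityMeasure Q] {dra dlb : EReal} (hab : a < b) (hK : 1 ≤ K)
    (hcont : ContinuousOn f (Set.Icc a b))
    (hmono : MonotoneOn f (Set.Icc a b) ∨ AntitoneOn f (Set.Icc a b))
    (hcvx : ConvexOn ℝ (Set.Icc a b) f ∨ ConcaveOn ℝ (Set.Icc a b) f)
    (hdra : Tendsto (fun y => (((f y - f a) / (y - a) : ℝ) : EReal))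
      (nhdsWithin a (Set.Ioi a)) (nhds dra))
    (hdlb : Tendsto (fun y => (((f b - f y) / (b - y) : ℝ) : EReal))
      (nhdsWithin b (Set.Iio b)) (nhds dlb))
    (hV : 0 < |f b - f a|)
    (hw : IsModulus Q (fun u => w0 + 1 * u ^ (1 : ℝ) / (b - a) ^ (1 : ℝ))) :
    linIndex dra dlb ((f b - f a) / (b - a)) ∈ Set.Icc 0 1 ∧
    ∃ l : ℝ → ℝ, IsLinearInterp f a b (2 * K) l ∧
      ∫⁻ y in Set.Icc a b, ENNReal.ofReal |f y - l y| ∂Q ≤ ENNReal.ofReal (|f b - f a| *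
        (w0 + linIndex dra dlb ((f b - f a) / (b - a)) / K ^ 2)) := by
  have hK0 : (0 : ℝ) < K := by exact_mod_cast hK
  have hba : 0 < b - a := sub_pos.2 hab
  have bounds := fun u (hu : u ∈ Set.Icc a b) v (hv : v ∈ Set.Icc a b) (huv : u < v) =>
    abs_slope_mem_Icc_of_tendsto hmono hcvx hdra hdlb hu.1 huv hv.2
  have hΔ := bounds a (Set.left_mem_Icc.2 hab.le) b (Set.right_mem_Icc.2 hab.le) hab
  rw [linIndex_eq (div_ne_zero (abs_pos.1 hV) hba.ne')]
  set m := min dra.abs dlb.abs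
  set M := max dra.abs dlb.abs
  have hm : m ≠ ⊤ := ne_top_of_le_ne_top ENNReal.ofReal_ne_top hΔ.1
  have hp : ∀ σ : ℝ, m ≤ ENNReal.ofReal |σ| → m.toReal ≤ |σ| := fun σ h =>
    ENNReal.toReal_le_of_le_ofReal (abs_nonneg σ) h
  have hR : ∀ σ : ℝ, ENNReal.ofReal |σ| ≤ M → M⁻¹.toReal * |σ| ≤ 1 := by
    intro σ h
    rw [← ENNReal.toReal_ofReal (abs_nonneg σ), ← ENNReal.toReal_mul]
    refine ENNReal.toReal_le_of_le_ofReal zero_le_one ?_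
    rw [ENNReal.ofReal_one]
    exact (mul_le_mul_right h _).trans (ENNReal.inv_mul_le_one M)
  have habs : ∀ u v : ℝ, u < v → |(f v - f u) / (v - u)| = |f v - f u| / (v - u) :=
    fun u v huv => by rw [abs_div, abs_of_pos (sub_pos.2 huv)]
  set p := m.toReal
  set R := M⁻¹.toReal
  have hp0 : 0 ≤ p := ENNReal.toReal_nonneg
  have hR0 : 0 ≤ R := ENNReal.toReal_nonneg
  have hps := hp _ hΔ.1
  have hRs := hR _ hΔ.2
  rw [habs a b hab] at hps hRs ⊢
  obtain ⟨l, hl, hint⟩ := exists_interp_of_slope_bounds (s := |f b - f a| / (b - a)) hab hK hcont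
    hmono hcvx (by positivity) hps hR0 hRs
    (fun u hu v hv huv => by
      have := hp _ (bounds u hu v hv huv).1
      rwa [habs u v huv, le_div_iff₀ (sub_pos.2 huv)] at this)
    (fun u hu v hv huv => by
      have := hR _ (bounds u hu v hv huv).2
      rwa [habs u v huv, ← mul_div_assoc, div_le_one (sub_pos.2 huv)] at this)
    one_pos ⟨one_pos, le_rfl⟩ hw
  set V := |f b - f a|
  set s := V / (b - a) with hs
  have hs0 : 0 < s := by positivity
  have h1 : p / s ≤ 1 := (div_le_one hs0).2 hps
  have h2 : 0 ≤ p / s := by positivity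
  have h3 : 0 ≤ s * R := by positivity
  have h4 : 0 ≤ 1 - 1 / 2 * (p / s + s * R) := by linarith
  refine ⟨⟨h4, by linarith⟩, l, hl, hint.trans (ENNReal.ofReal_le_ofReal ?_)⟩
  have h5 : (s - p) * (b - a) / (4 * K ^ 2) + (V * w0 + 1 / (b - a) ^ (1 : ℝ) *
      ((V / K) ^ (1 + 1 : ℝ) * (1 / 4) ^ (1 : ℝ)) * (((1 / s) ^ (1 : ℝ) - R ^ (1 : ℝ)) / 1))
      = V * (w0 + (1 - 1 / 2 * (p / s + s * R)) / K ^ 2 / 2) := by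
    rw [one_add_one_eq_two, Real.rpow_two]
    simp only [Real.rpow_one, hs]
    field_simp
    ring
  rw [h5]
  refine mul_le_mul_of_nonneg_left ?_ hV.le
  linarith [half_le_self (div_nonneg h4 (sq_nonneg (K : ℝ)))]

end Interpolation

/-- Theorem 3, consequences: if `Q` has modulus
`w(u) = w(0) + A·u^α/(b−a)^α` with `A ≥ 1`, `α ∈ (0,1]`, there is a `2K`-linear
interpolation `fbar` of `f` with
`∫ |f − fbar| dQ ≤ V·[w(0) + (2^{1−α}A/(αK^{1+3α}))^{1/(1+α)}]`; moreover when
`α = 1` and `A = 1`, this `fbar` satisfies `∫ |f − fbar| dQ ≤ V·[w(0) + Γ/K²]`. -/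
theorem stmt12 (a b : ℝ) (hab : a < b) (Q : Measure ℝ) [IsProbabilityMeasure Q]
    (hQ : Q (Set.Icc a b)ᶜ = 0) (K : ℕ) (hK : 1 ≤ K) (f : ℝ → ℝ)
    (hcont : ContinuousOn f (Set.Icc a b))
    (hmono : MonotoneOn f (Set.Icc a b) ∨ AntitoneOn f (Set.Icc a b))
    (hcvx : ConvexOn ℝ (Set.Icc a b) f ∨ ConcaveOn ℝ (Set.Icc a b) f)
    (dra dlb : EReal)
    (hdra : Tendsto (fun y => (((f y - f a) / (y - a) : ℝ) : EReal))
      (nhdsWithin a (Set.Ioi a)) (nhds dra))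
    (hdlb : Tendsto (fun y => (((f b - f y) / (b - y) : ℝ) : EReal))
      (nhdsWithin b (Set.Iio b)) (nhds dlb))
    (V : ℝ) (hV : V = |f b - f a|)
    (Γ : ℝ) (hΓ : Γ = linIndex dra dlb ((f b - f a) / (b - a)))
    (w0 A α : ℝ) (hA : 1 ≤ A) (hα : α ∈ Set.Ioc (0 : ℝ) 1)
    (hw : IsModulus Q (fun u => w0 + A * u ^ α / (b - a) ^ α)) :
    ∃ fbar : ℝ → ℝ, IsLinearInterp f a b (2 * K) fbar ∧
      ∫⁻ y in Set.Icc a b, ENNReal.ofReal |f y - fbar y| ∂Q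
        ≤ ENNReal.ofReal (V * (w0 +
            (2 ^ (1 - α) * A / (α * (K : ℝ) ^ (1 + 3 * α))) ^ (1 / (1 + α)))) ∧
      (α = 1 → A = 1 →
        ∫⁻ y in Set.Icc a b, ENNReal.ofReal |f y - fbar y| ∂Q
          ≤ ENNReal.ofReal (V * (w0 + Γ / K ^ 2))) := by
  subst hV hΓ
  have hA0 : 0 < A := one_pos.trans_le hA
  rcases (abs_nonneg (f b - f a)).eq_or_lt with h0 | hpos
  · obtain ⟨l, hl, hint⟩ := exists_interp_of_const (Q := Q) hab hK hmono
      (sub_eq_zero.1 (abs_eq_zero.1 h0.symm))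
    exact ⟨l, hl, hint.trans (by simp), fun _ _ => hint.trans (by simp)⟩
  by_cases h1 : α = 1 ∧ A = 1
  · obtain ⟨rfl, rfl⟩ := h1
    obtain ⟨hΓ, l, hl, hint⟩ := exists_interp_linIndex hab hK hcont hmono hcvx hdra hdlb hpos hw
    refine ⟨l, hl, hint.trans (ENNReal.ofReal_le_ofReal ?_), fun _ _ => hint⟩
    have hK0 : (0 : ℝ) ≤ K := K.cast_nonneg
    have e : ((2 : ℝ) ^ (1 - 1 : ℝ) * 1 / (1 * (K : ℝ) ^ (1 + 3 * 1 : ℝ))) ^ (1 / (1 + 1) : ℝ)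
        = 1 / (K : ℝ) ^ 2 := by
      rw [sub_self, Real.rpow_zero, one_mul, one_mul, ← Real.rpow_two,
        Real.div_rpow zero_le_one (by positivity), Real.one_rpow, ← Real.rpow_mul hK0]
      norm_num
    rw [e]
    gcongr
    exact hΓ.2
  · obtain ⟨l, hl, hint⟩ := exists_interp_rpow hab hK hcont hmono hcvx hpos hA0 hα hw
    exact ⟨l, hl, hint, fun hα1 hA1 => absurd ⟨hα1, hA1⟩ h1⟩
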